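/- Let X₁, X₂ be independent random variables with distributions F₁, F₂ ∈ 𝓡₁₁(α), i.e., F̄ᵢ(x) ∼ x^{−α} fᵢ(ln x) with α > 0, fᵢ regularly varying of index γᵢ > −1. Then P(X₁⁺ · X₂⁺ > x) ∼ α B(γ₁+1, γ₂+1) x^{−α} (ln x) f₁(ln x) f₂(ln x) as x → ∞, where Xᵢ⁺ = max(Xᵢ, 0). -/

import Mathlib

open Filter MeasureTheory Asymptotics

/-- A measure on `ℝ` is lattice if it is concentrated on `{a + n d : n ∈ ℤ}`
for some `d > 0`. -/
def IsLatticeMeasure (μ : Measure ℝ) : Prop :=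
  ∃ a d : ℝ, 0 < d ∧ μ (Set.range fun n : ℤ => a + n * d) = 1

/-- The Beta function `B(a,b) = Γ(a)Γ(b)/Γ(a+b)`. -/
noncomputable def Beta (a b : ℝ) : ℝ := Real.Gamma a * Real.Gamma b / Real.Gamma (a + b)

/-- Uniform convergence theorem for slowly varying functions, in additive form. -/
theorem uniform_of_tendsto_shift_sub {k : ℝ → ℝ} (hk : Measurable k)
    (h : ∀ s, Tendsto (fun v => k (v + s) - k v) atTop (nhds 0)) {ε : ℝ} (hε : 0 < ε) :
    ∃ V, ∀ v ≥ V, ∀ u ∈ Set.Icc (0 : ℝ) 1, |k (v + u) - k v| ≤ ε := by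
  set D : ℝ → ℝ → ℝ := fun v s => min 1 |k (v + s) - k v| with hD
  have hDm : ∀ v, Measurable (D v) := fun v => by simp only [hD]; fun_prop
  have hD0 : ∀ v s, 0 ≤ D v s := fun v s => le_min zero_le_one (abs_nonneg _)
  have hD1 : ∀ v s, D v s ≤ 1 := fun v s => min_le_left _ _
  have hDi : ∀ v a b, IntervalIntegrable (D v) volume a b := fun v a b =>
    (intervalIntegrable_const (c := (1 : ℝ))).mono_fun (hDm v).aestronglyMeasurable
      (Eventually.of_forall fun s => by
        simpa [abs_of_nonneg (hD0 v s)] using hD1 v s)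
  set ψ : ℝ → ℝ := fun v => ∫ s in (0 : ℝ)..2, D v s with hψ
  have hψ0 : Tendsto ψ atTop (nhds 0) := by
    have := intervalIntegral.tendsto_integral_filter_of_dominated_convergence
      (μ := volume) (a := 0) (b := 2) (l := atTop) (F := D) (f := fun _ => 0) (fun _ => (1 : ℝ))
      (Eventually.of_forall fun v => (hDm v).aestronglyMeasurable)
      (Eventually.of_forall fun v => Eventually.of_forall fun s _ => by
        simpa [abs_of_nonneg (hD0 v s)] using hD1 v s)
      intervalIntegrable_const
      (Eventually.of_forall fun s _ => by
        have h1 := (tendsto_const_nhds (x := (1 : ℝ))).min (h s).abs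
        simpa [hD] using h1)
    simpa [hψ] using this
  have key : ∀ v, ∀ u ∈ Set.Icc (0 : ℝ) 1, min 1 |k (v + u) - k v| ≤ ψ v + ψ (v + u) := by
    intro v u hu
    have h1 : ∫ s in (1 : ℝ)..2, D v s ≤ ψ v :=
      intervalIntegral.integral_mono_interval zero_le_one one_le_two le_rfl
        (Eventually.of_forall (hD0 v)) (hDi v 0 2)
    have h2 : ∫ s in (1 : ℝ)..2, D (v + u) (s - u) ≤ ψ (v + u) := by
      rw [intervalIntegral.integral_comp_sub_right (D (v + u)) u]
      exact intervalIntegral.integral_mono_interval (by linarith [hu.2]) (by linarith)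
        (by linarith [hu.1]) (Eventually.of_forall (hD0 _)) (hDi _ 0 2)
    have hi2 : IntervalIntegrable (fun s => D (v + u) (s - u)) volume 1 2 := by
      have := (hDi (v + u) (1 - u) (2 - u)).comp_sub_right u
      simpa using this
    have h3 : ∫ _ in (1 : ℝ)..2, min 1 |k (v + u) - k v|
        ≤ ∫ s in (1 : ℝ)..2, (D v s + D (v + u) (s - u)) := by
      refine intervalIntegral.integral_mono_on one_le_two intervalIntegrable_const
        ((hDi v 1 2).add hi2) fun s _ => ?_
      simp only [hD, show v + u + (s - u) = v + s by ring]
      have tri : |k (v + u) - k v| ≤ |k (v + s) - k v| + |k (v + s) - k (v + u)| := by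
        have := abs_sub_le (k (v + u)) (k (v + s)) (k v)
        rw [abs_sub_comm (k (v + u)) (k (v + s))] at this
        linarith
      have := abs_nonneg (k (v + s) - k v)
      have := abs_nonneg (k (v + s) - k (v + u))
      rcases le_total 1 |k (v + s) - k v| with a | a <;>
      rcases le_total 1 |k (v + s) - k (v + u)| with b | b <;>
      simp only [min_eq_left, min_eq_right, a, b]
      · linarith [min_le_left 1 |k (v + u) - k v|]
      · linarith [min_le_left 1 |k (v + u) - k v|]
      · linarith [min_le_left 1 |k (v + u) - k v|]
      · linarith [min_le_right 1 |k (v + u) - k v|]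
    rw [intervalIntegral.integral_add (hDi v 1 2) hi2, intervalIntegral.integral_const] at h3
    rw [show (2 : ℝ) - 1 = 1 by norm_num, one_smul] at h3
    linarith
  have hδ : 0 < min ε 1 / 4 := by positivity
  obtain ⟨V, hV⟩ := eventually_atTop.1 (hψ0.eventually (gt_mem_nhds hδ))
  refine ⟨V, fun v hv u hu => ?_⟩
  have h1 := key v u hu
  have h2 := hV v hv
  have h3 := hV (v + u) (by linarith [hu.1])
  have h4 : min 1 |k (v + u) - k v| < min ε 1 := by
    have : 0 < min ε 1 := by positivity
    linarith
  rcases min_lt_iff.1 h4 with h5 | h5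
  · exact absurd h5 (not_lt.2 (min_le_right _ _))
  · exact (h5.trans_le (min_le_left _ _)).le

/-- Uniform convergence theorem for regularly varying functions, in logarithmic form. -/
theorem RegVar.log_uniform {g : ℝ → ℝ} {γ : ℝ} (hg : Measurable g)
    (hpos : ∀ᶠ x in atTop, 0 < g x)
    (hrv : ∀ t : ℝ, 0 < t → Tendsto (fun x => g (x * t) / g x) atTop (nhds (t ^ γ)))
    {ε : ℝ} (hε : 0 < ε) :
    ∃ X > 0, ∀ x ≥ X, 0 < g x ∧
      ∀ t ∈ Set.Icc (1 : ℝ) (Real.exp 1),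
        |Real.log (g (x * t)) - Real.log (g x) - γ * Real.log t| ≤ ε := by
  obtain ⟨X₀, hX₀⟩ := eventually_atTop.1 hpos
  have hk : Measurable fun v => Real.log (g (Real.exp v)) - γ * v := by fun_prop
  obtain ⟨V, hV⟩ := uniform_of_tendsto_shift_sub hk (fun s => by
    have h1 := ((hrv (Real.exp s) (Real.exp_pos s)).comp Real.tendsto_exp_atTop).log
      (Real.rpow_pos_of_pos (Real.exp_pos s) γ).ne'
    rw [Real.log_rpow (Real.exp_pos s), Real.log_exp] at h1
    have h2 := h1.sub_const (γ * s)
    rw [sub_self] at h2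
    refine h2.congr' ?_
    filter_upwards [Real.tendsto_exp_atTop.eventually_ge_atTop X₀,
      (tendsto_atTop_add_const_right atTop s tendsto_id |> Real.tendsto_exp_atTop.comp
        ).eventually_ge_atTop X₀] with v hv hvs
    have hvs' : X₀ ≤ Real.exp (v + s) := hvs
    simp only [Function.comp_apply, ← Real.exp_add]
    rw [Real.log_div (hX₀ _ hvs').ne' (hX₀ _ hv).ne']
    ring) hε
  refine ⟨max X₀ (Real.exp V), lt_max_of_lt_right (Real.exp_pos _), fun x hx => ?_⟩
  have hx0 : 0 < x := (Real.exp_pos V).trans_le ((le_max_right _ _).trans hx)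
  refine ⟨hX₀ x ((le_max_left _ _).trans hx), fun t ht => ?_⟩
  have ht0 : 0 < t := by linarith [ht.1]
  have h1 := hV (Real.log x) ((Real.le_log_iff_exp_le hx0).2 ((le_max_right _ _).trans hx))
    (Real.log t) ⟨Real.log_nonneg ht.1, (Real.log_le_iff_le_exp ht0).2 ht.2⟩
  rw [Real.exp_add, Real.exp_log hx0, Real.exp_log ht0] at h1
  refine le_of_eq_of_le ?_ h1
  congr 1; ring

theorem RegVar.tendsto_shift_div {g : ℝ → ℝ} {γ : ℝ} (hg : Measurable g)
    (hpos : ∀ᶠ x in atTop, 0 < g x)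
    (hrv : ∀ t : ℝ, 0 < t → Tendsto (fun x => g (x * t) / g x) atTop (nhds (t ^ γ)))
    {h : ℝ} (hh : 0 ≤ h) : Tendsto (fun x => g (x + h) / g x) atTop (nhds 1) := by
  have ht : Tendsto (fun x : ℝ => 1 + h / x) atTop (nhds 1) := by
    simpa using (tendsto_const_nhds (x := h)).div_atTop tendsto_id |>.const_add 1
  have hlog : Tendsto (fun x : ℝ => γ * Real.log (1 + h / x)) atTop (nhds 0) := by
    simpa using (ht.log one_ne_zero).const_mul γ
  have hd : Tendsto (fun x => Real.log (g (x + h)) - Real.log (g x)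
      - γ * Real.log (1 + h / x)) atTop (nhds 0) := by
    rw [Metric.tendsto_atTop']
    intro ε hε
    obtain ⟨X, hX0, hX⟩ := RegVar.log_uniform hg hpos hrv (half_pos hε)
    obtain ⟨Y, hY⟩ := eventually_atTop.1 (ht.eventually (gt_mem_nhds
      (show (1 : ℝ) < Real.exp 1 by simp)))
    refine ⟨max X Y, fun x hx => ?_⟩
    have hxX : X < x := (le_max_left _ _).trans_lt hx
    have hx0 : 0 < x := hX0.trans hxX
    have h1 := (hX x hxX.le).2 (1 + h / x) ⟨by linarith [div_nonneg hh hx0.le],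
      (hY x ((le_max_right _ _).trans hx.le)).le⟩
    rw [show x * (1 + h / x) = x + h by field_simp] at h1
    rw [Real.dist_eq, sub_zero]
    linarith
  have h2 := (Real.continuous_exp.tendsto 0).comp (show Tendsto (fun x =>
    Real.log (g (x + h)) - Real.log (g x)) atTop (nhds 0) by simpa using hd.add hlog)
  rw [Real.exp_zero] at h2
  refine h2.congr' ?_
  filter_upwards [hpos, (tendsto_atTop_add_const_right atTop h tendsto_id).eventually hpos]
    with x h3 h4
  simp only [id] at h4
  simp only [Function.comp_apply]
  rw [Real.exp_sub, Real.exp_log h3, Real.exp_log h4]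

/-- A one-sided Potter bound, valid down to the origin. -/
theorem RegVar.potter_bound {g : ℝ → ℝ} {γ : ℝ} (hγ : -1 < γ) (hg : Measurable g)
    (hbdd : ∀ r : ℝ, ∃ K : ℝ, ∀ x ∈ Set.Icc (0 : ℝ) r, g x ≤ K)
    (hpos : ∀ᶠ x in atTop, 0 < g x)
    (hrv : ∀ t : ℝ, 0 < t → Tendsto (fun x => g (x * t) / g x) atTop (nhds (t ^ γ))) :
    ∃ β < (1 : ℝ), ∃ C > 0, ∃ X > 0, ∀ x ≥ X, 0 < g x ∧
      ∀ y ∈ Set.Ioc 0 x, g y ≤ C * g x * (x / y) ^ β := by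
  set β : ℝ := (1 + max (-γ) 0) / 2 with hβ
  have hm : max (-γ) 0 < 1 := max_lt (by linarith) one_pos
  have hm0 : 0 ≤ max (-γ) 0 := le_max_right _ _
  have hmg : -γ ≤ max (-γ) 0 := le_max_left _ _
  have hβ1 : β < 1 := by linarith
  have hβ0 : 0 < β := by linarith
  have hε : 0 < γ + β := by linarith
  obtain ⟨X, hX0, hX⟩ := RegVar.log_uniform hg hpos hrv hε
  set c : ℝ := γ + β + |γ| with hc
  have hstep : ∀ x ≥ X, ∀ n : ℕ,
      Real.log (g x) - β * n ≤ Real.log (g (x * Real.exp n)) := by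
    intro x hx n
    induction n with
    | zero => simp
    | succ n ih =>
      have hx0 : 0 < x := hX0.trans_le hx
      have h1 : X ≤ x * Real.exp n := hx.trans (le_mul_of_one_le_right hx0.le
        (Real.one_le_exp n.cast_nonneg))
      have h2 := (hX _ h1).2 (Real.exp 1) ⟨by simp, le_rfl⟩
      rw [mul_assoc, ← Real.exp_add, Real.log_exp] at h2
      have h3 := (abs_le.1 h2).1
      push_cast
      linarith
  have hlarge : ∀ y ≥ X, ∀ x ≥ y, g y ≤ Real.exp c * g x * (x / y) ^ β := by
    intro y hy x hx
    have hy0 : 0 < y := hX0.trans_le hy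
    have hx0 : 0 < x := hy0.trans_le hx
    have hl : 0 ≤ Real.log (x / y) := Real.log_nonneg ((one_le_div hy0).2 hx)
    set n := ⌊Real.log (x / y)⌋₊ with hn
    have hn1 : (n : ℝ) ≤ Real.log (x / y) := Nat.floor_le hl
    have hn2 : Real.log (x / y) < n + 1 := Nat.lt_floor_add_one _
    have h1 := hstep y hy n
    have h2 : X ≤ y * Real.exp n := hy.trans (le_mul_of_one_le_right hy0.le
        (Real.one_le_exp n.cast_nonneg))
    have h3 := (hX _ h2).2 (Real.exp (Real.log (x / y) - n))
      ⟨Real.one_le_exp (by linarith), Real.exp_le_exp.2 (by linarith)⟩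
    rw [mul_assoc, ← Real.exp_add, add_sub_cancel, Real.exp_log (by positivity),
      mul_div_cancel₀ _ hy0.ne', Real.log_exp] at h3
    have h4 := (abs_le.1 h3).1
    have h5 : -|γ| ≤ γ * (Real.log (x / y) - n) := by
      have h6 : |γ * (Real.log (x / y) - n)| ≤ |γ| := by
        rw [abs_mul]
        refine mul_le_of_le_one_right (abs_nonneg _) ?_
        rw [abs_le]; constructor <;> linarith
      exact (abs_le.1 h6).1
    have h7 : β * n ≤ β * Real.log (x / y) := by gcongr
    have h8 : Real.log (g y) ≤ c + Real.log (g x) + Real.log (x / y) * β := by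
      rw [hc]; linarith
    have gy := (hX y hy).1
    have gx := (hX x (hy.trans hx)).1
    rw [Real.rpow_def_of_pos (by positivity)]
    calc g y = Real.exp (Real.log (g y)) := (Real.exp_log gy).symm
      _ ≤ Real.exp (c + Real.log (g x) + Real.log (x / y) * β) := Real.exp_le_exp.2 h8
      _ = _ := by rw [Real.exp_add, Real.exp_add, Real.exp_log gx]
  obtain ⟨K, hK⟩ := hbdd X
  have gX := (hX X le_rfl).1
  refine ⟨β, hβ1, Real.exp c * max 1 (K / g X), by positivity, X, hX0, fun x hx =>
    ⟨(hX x hx).1, fun y hy => ?_⟩⟩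
  have gx := (hX x hx).1
  have hx0 : 0 < x := hX0.trans_le hx
  rcases le_total X y with hXy | hXy
  · refine (hlarge y hXy x hy.2).trans ?_
    have := hy.1
    gcongr
    exact le_mul_of_one_le_right (Real.exp_pos _).le (le_max_left _ _)
  · have h1 := hlarge X le_rfl x hx
    have h2 : (x / X) ^ β ≤ (x / y) ^ β := by
      have := hy.1
      gcongr
    calc g y ≤ K := hK y ⟨hy.1.le, hXy⟩
      _ = K / g X * g X := by field_simp
      _ ≤ max 1 (K / g X) * g X := by gcongr; exact le_max_right _ _
      _ ≤ max 1 (K / g X) * (Real.exp c * g x * (x / y) ^ β) := by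
        gcongr
        exact h1.trans (by gcongr)
      _ = _ := by ring

theorem RegVar.tendsto_self_mul_atTop {g : ℝ → ℝ} {γ : ℝ} (hγ : -1 < γ) (hg : Measurable g)
    (hbdd : ∀ r : ℝ, ∃ K : ℝ, ∀ x ∈ Set.Icc (0 : ℝ) r, g x ≤ K)
    (hpos : ∀ᶠ x in atTop, 0 < g x)
    (hrv : ∀ t : ℝ, 0 < t → Tendsto (fun x => g (x * t) / g x) atTop (nhds (t ^ γ))) :
    Tendsto (fun x => x * g x) atTop atTop := by
  obtain ⟨β, hβ, C, hC, X, hX0, hX⟩ := RegVar.potter_bound hγ hg hbdd hpos hrv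
  have gX := (hX X le_rfl).1
  refine tendsto_atTop_mono' atTop (f₁ := fun x => g X / C * X ^ β * x ^ (1 - β)) ?_
    ((tendsto_rpow_atTop (by linarith : 0 < 1 - β)).const_mul_atTop (by positivity))
  filter_upwards [eventually_ge_atTop X] with x hx
  have hx0 : 0 < x := hX0.trans_le hx
  have h1 := (hX x hx).2 X ⟨hX0, hx⟩
  rw [Real.div_rpow hx0.le hX0.le] at h1
  rw [Real.rpow_sub hx0, Real.rpow_one]
  have h2 : 0 < X ^ β := by positivity
  have h3 : 0 < x ^ β := by positivity
  calc g X / C * X ^ β * (x / x ^ β)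
      ≤ (C * g x * (x ^ β / X ^ β)) / C * X ^ β * (x / x ^ β) := by gcongr
    _ = x * g x := by field_simp

/-- An antitone function whose unit-step ratio tends to some `ρ < 1` has tail integral of the
order of the function itself. -/
theorem integral_Ioi_le_of_tendsto_shift_ratio {H : ℝ → ℝ} (hH : Antitone H)
    (hpos : ∀ᶠ x in atTop, 0 < H x) {c : ℝ} (hc : 0 < c)
    (hr : ∀ᶠ x in atTop, H (x + 1) / H x ≤ Real.exp (-c)) :
    ∃ C > 0, ∀ᶠ x in atTop, IntegrableOn H (Set.Ioi x) ∧ ∫ y in Set.Ioi x, H y ≤ C * H x := by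
  obtain ⟨X, hX⟩ := eventually_atTop.1 (hpos.and hr)
  refine ⟨Real.exp c / c, by positivity, ?_⟩
  filter_upwards [eventually_ge_atTop X] with x hx
  have hn : ∀ n : ℕ, H (x + n) ≤ Real.exp (-c * n) * H x := by
    intro n
    induction n with
    | zero => simp
    | succ n ih =>
      have hxn : X ≤ x + n := hx.trans (le_add_of_nonneg_right n.cast_nonneg)
      have h1 := (div_le_iff₀ (hX _ hxn).1).1 (hX _ hxn).2
      push_cast
      rw [← add_assoc, mul_add, Real.exp_add]
      calc _ ≤ _ := h1
        _ ≤ Real.exp (-c) * (Real.exp (-c * n) * H x) := by gcongr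
        _ = _ := by ring_nf
  have hb : ∀ y ∈ Set.Ioi x, H y ≤ Real.exp c * H x * Real.exp (c * x) * Real.exp (-c * y) := by
    intro y hy
    have hy' : 0 ≤ y - x := sub_nonneg.2 (le_of_lt hy)
    have h1 : (⌊y - x⌋₊ : ℝ) ≤ y - x := Nat.floor_le hy'
    have h2 := Nat.lt_floor_add_one (y - x)
    have hx0 := (hX x hx).1
    calc H y ≤ H (x + ⌊y - x⌋₊) := hH (by linarith)
      _ ≤ Real.exp (-c * ⌊y - x⌋₊) * H x := hn _
      _ ≤ Real.exp (c + c * x + -c * y) * H x := by gcongr; nlinarith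
      _ = _ := by rw [Real.exp_add, Real.exp_add]; ring
  have hi : IntegrableOn (fun y => Real.exp c * H x * Real.exp (c * x) * Real.exp (-c * y))
      (Set.Ioi x) := (integrableOn_exp_mul_Ioi (neg_lt_zero.2 hc) x).const_mul _
  have hHi : IntegrableOn H (Set.Ioi x) := by
    refine hi.mono' hH.measurable.aestronglyMeasurable ?_
    refine (ae_restrict_mem measurableSet_Ioi).mono fun y hy => ?_
    rw [Real.norm_of_nonneg]
    · exact hb y hy
    · exact (hX y (hx.trans (le_of_lt hy))).1.le
  refine ⟨hHi, (setIntegral_mono_on hHi hi measurableSet_Ioi hb).trans_eq ?_⟩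
  rw [integral_const_mul, integral_exp_mul_Ioi (neg_lt_zero.2 hc), neg_div_neg_eq]
  rw [mul_div_assoc', mul_assoc _ (Real.exp (c * x)), ← Real.exp_add]
  simp
  ring

theorem integrable_and_integral_eq_Beta {a b : ℝ} (ha : 0 < a) (hb : 0 < b) :
    IntervalIntegrable (fun s : ℝ => s ^ (a - 1) * (1 - s) ^ (b - 1)) volume 0 1 ∧
      ∫ s in (0 : ℝ)..1, s ^ (a - 1) * (1 - s) ^ (b - 1) = Beta a b := by
  have hEq : Set.EqOn (fun s : ℝ => (s : ℂ) ^ ((a : ℂ) - 1) * (1 - (s : ℂ)) ^ ((b : ℂ) - 1))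
      (fun s : ℝ => ((s ^ (a - 1) * (1 - s) ^ (b - 1) : ℝ) : ℂ)) (Set.uIcc 0 1) := by
    intro s hs
    rw [Set.uIcc_of_le zero_le_one] at hs
    simp only
    rw [Complex.ofReal_mul, Complex.ofReal_cpow hs.1, Complex.ofReal_cpow (sub_nonneg.2 hs.2)]
    push_cast
    rfl
  constructor
  · have h1 := Complex.betaIntegral_convergent (u := a) (v := b) (by simpa) (by simpa)
    have h2 := h1.congr (hEq.mono Set.uIoc_subset_uIcc)
    rw [intervalIntegrable_iff] at h2 ⊢
    simpa [IntegrableOn] using h2.re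
  · have h1 := ProbabilityTheory.beta_eq_betaIntegralReal a b ha hb
    rw [Complex.betaIntegral, intervalIntegral.integral_congr hEq,
      intervalIntegral.integral_ofReal, Complex.ofReal_re] at h1
    exact h1.symm

theorem Beta_pos {a b : ℝ} (ha : 0 < a) (hb : 0 < b) : 0 < Beta a b :=
  ProbabilityTheory.beta_pos ha hb

theorem RegVar.tendsto_integral_mul {g₁ g₂ : ℝ → ℝ} {γ₁ γ₂ : ℝ} (hγ₁ : -1 < γ₁) (hγ₂ : -1 < γ₂)
    (hg₁ : Measurable g₁) (hg₂ : Measurable g₂) (hnn₁ : ∀ x, 0 ≤ g₁ x) (hnn₂ : ∀ x, 0 ≤ g₂ x)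
    (hbdd₁ : ∀ r : ℝ, ∃ K : ℝ, ∀ x ∈ Set.Icc (0 : ℝ) r, g₁ x ≤ K)
    (hbdd₂ : ∀ r : ℝ, ∃ K : ℝ, ∀ x ∈ Set.Icc (0 : ℝ) r, g₂ x ≤ K)
    (hpos₁ : ∀ᶠ x in atTop, 0 < g₁ x) (hpos₂ : ∀ᶠ x in atTop, 0 < g₂ x)
    (hrv₁ : ∀ t : ℝ, 0 < t → Tendsto (fun x => g₁ (x * t) / g₁ x) atTop (nhds (t ^ γ₁)))
    (hrv₂ : ∀ t : ℝ, 0 < t → Tendsto (fun x => g₂ (x * t) / g₂ x) atTop (nhds (t ^ γ₂))) :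
    Tendsto (fun x => ∫ s in (0 : ℝ)..1, g₁ (x * s) / g₁ x * (g₂ (x * (1 - s)) / g₂ x)) atTop
      (nhds (Beta (γ₁ + 1) (γ₂ + 1))) := by
  obtain ⟨β₁, hβ₁, C₁, hC₁, X₁, hX₁, h₁⟩ := RegVar.potter_bound hγ₁ hg₁ hbdd₁ hpos₁ hrv₁
  obtain ⟨β₂, hβ₂, C₂, hC₂, X₂, hX₂, h₂⟩ := RegVar.potter_bound hγ₂ hg₂ hbdd₂ hpos₂ hrv₂
  have hne : ∀ᵐ s : ℝ, s ≠ 1 := by simp [ae_iff]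
  have hint := (integrable_and_integral_eq_Beta (a := 1 - β₁) (b := 1 - β₂)
    (by linarith) (by linarith)).1.const_mul (C₁ * C₂)
  have hval := (integrable_and_integral_eq_Beta (a := γ₁ + 1) (b := γ₂ + 1)
    (by linarith) (by linarith)).2
  rw [← hval]
  have hle : ∀ (g : ℝ → ℝ) (β C x s : ℝ), 0 < s → s ≤ 1 → 0 < x → 0 < g x →
      (∀ y ∈ Set.Ioc 0 x, g y ≤ C * g x * (x / y) ^ β) →
      g (x * s) / g x ≤ C * s ^ (1 - β - 1) := by
    intro g β C x s hs hs1 hx hgx h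
    rw [div_le_iff₀ hgx]
    refine (h (x * s) ⟨by positivity, mul_le_of_le_one_right hx.le hs1⟩).trans_eq ?_
    rw [show x / (x * s) = s⁻¹ by field_simp, Real.inv_rpow hs.le, ← Real.rpow_neg hs.le,
      show 1 - β - 1 = -β by ring]
    ring
  refine intervalIntegral.tendsto_integral_filter_of_dominated_convergence _
    (Eventually.of_forall fun x => ?_) ?_ hint ?_
  · exact (by fun_prop : Measurable fun s =>
      g₁ (x * s) / g₁ x * (g₂ (x * (1 - s)) / g₂ x)).aestronglyMeasurable
  · filter_upwards [eventually_ge_atTop X₁, eventually_ge_atTop X₂] with x hx₁ hx₂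
    filter_upwards [hne] with s hs1 hs
    rw [Set.uIoc_of_le zero_le_one] at hs
    have hs1' : s < 1 := lt_of_le_of_ne hs.2 hs1
    have hx0 : 0 < x := hX₁.trans_le hx₁
    have e1 := hle g₁ β₁ C₁ x s hs.1 hs.2 hx0 (h₁ x hx₁).1 (h₁ x hx₁).2
    have e2 := hle g₂ β₂ C₂ x (1 - s) (by linarith) (by linarith [hs.1]) hx0 (h₂ x hx₂).1
      (h₂ x hx₂).2
    have n1 : 0 ≤ g₁ (x * s) / g₁ x := div_nonneg (hnn₁ _) (hnn₁ _)
    have n2 : 0 ≤ g₂ (x * (1 - s)) / g₂ x := div_nonneg (hnn₂ _) (hnn₂ _)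
    rw [Real.norm_of_nonneg (mul_nonneg n1 n2)]
    calc _ ≤ _ := mul_le_mul e1 e2 n2 (n1.trans e1)
      _ = _ := by ring
  · filter_upwards [hne] with s hs1 hs
    rw [Set.uIoc_of_le zero_le_one] at hs
    have hs1' : s < 1 := lt_of_le_of_ne hs.2 hs1
    rw [add_sub_cancel_right, add_sub_cancel_right]
    exact (hrv₁ s hs.1).mul (hrv₂ (1 - s) (by linarith))

/-- `H` is a tail function with values in `[0, 1]` such that `exp (α u) * H u` is regularly varying
of index `γ` at infinity. -/
structure IsExpRegVarTail (α γ : ℝ) (H : ℝ → ℝ) : Prop where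
  antitone : Antitone H
  nonneg : ∀ u, 0 ≤ H u
  le_one : ∀ u, H u ≤ 1
  eventually_pos : ∀ᶠ u in atTop, 0 < H u
  regVar : ∀ t : ℝ, 0 < t →
    Tendsto (fun u => (Real.exp (α * (u * t)) * H (u * t)) / (Real.exp (α * u) * H u)) atTop
      (nhds (t ^ γ))

namespace IsExpRegVarTail

variable {α γ γ₁ γ₂ : ℝ} {H H₁ H₂ : ℝ → ℝ}

theorem measurable_exp_mul (h : IsExpRegVarTail α γ H) :
    Measurable fun u => Real.exp (α * u) * H u := by
  have := h.antitone.measurable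
  fun_prop

theorem eventually_exp_mul_pos (h : IsExpRegVarTail α γ H) :
    ∀ᶠ u in atTop, 0 < Real.exp (α * u) * H u :=
  h.eventually_pos.mono fun _ hu => mul_pos (Real.exp_pos _) hu

theorem exp_mul_bdd (h : IsExpRegVarTail α γ H) (hα : 0 < α) (r : ℝ) :
    ∃ K : ℝ, ∀ u ∈ Set.Icc (0 : ℝ) r, Real.exp (α * u) * H u ≤ K :=
  ⟨Real.exp (α * r), fun u hu => by
    have h1 : Real.exp (α * u) ≤ Real.exp (α * r) := by gcongr; exact hu.2
    calc _ ≤ Real.exp (α * r) * 1 :=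
          mul_le_mul h1 (h.le_one u) (h.nonneg u) (Real.exp_pos _).le
      _ = _ := mul_one _⟩

theorem tendsto_shift_div (h : IsExpRegVarTail α γ H) {s : ℝ} (hs : 0 ≤ s) :
    Tendsto (fun u => (Real.exp (α * (u + s)) * H (u + s)) / (Real.exp (α * u) * H u)) atTop
      (nhds 1) :=
  RegVar.tendsto_shift_div h.measurable_exp_mul h.eventually_exp_mul_pos h.regVar hs

theorem tendsto_self_mul_atTop (h : IsExpRegVarTail α γ H) (hα : 0 < α) (hγ : -1 < γ) :
    Tendsto (fun u => u * (Real.exp (α * u) * H u)) atTop atTop :=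
  RegVar.tendsto_self_mul_atTop hγ h.measurable_exp_mul (h.exp_mul_bdd hα)
    h.eventually_exp_mul_pos h.regVar

theorem integral_Ioi_le (h : IsExpRegVarTail α γ H) (hα : 0 < α) :
    ∃ C > 0, ∀ᶠ x in atTop, IntegrableOn H (Set.Ioi x) ∧ ∫ y in Set.Ioi x, H y ≤ C * H x := by
  refine integral_Ioi_le_of_tendsto_shift_ratio h.antitone h.eventually_pos (half_pos hα) ?_
  have h1 := (h.tendsto_shift_div zero_le_one).eventually (ge_mem_nhds
    (show (1 : ℝ) < Real.exp (α / 2) by simpa using hα))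
  filter_upwards [h1] with u hu
  rw [mul_add, mul_one, Real.exp_add, mul_assoc, mul_div_mul_left _ _ (Real.exp_pos _).ne',
    mul_div_assoc, ← le_div_iff₀' (Real.exp_pos _), ← Real.exp_sub] at hu
  rwa [show -(α / 2) = α / 2 - α by ring]

theorem convolution_bounds (h₁ : IsExpRegVarTail α γ₁ H₁) (h₂ : IsExpRegVarTail α γ₂ H₂)
    (hα : 0 < α) :
    ∃ C₁ C₂ : ℝ, ∀ᶠ x in atTop, Integrable (fun y => H₁ y * H₂ (x - y)) ∧
      ∫ y in (0 : ℝ)..x, H₁ y * H₂ (x - y) ≤ ∫ y, H₁ y * H₂ (x - y) ∧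
      ∫ y, H₁ y * H₂ (x - y) ≤ (∫ y in (0 : ℝ)..x, H₁ y * H₂ (x - y)) + C₁ * H₁ x + C₂ * H₂ x := by
  obtain ⟨C₁, -, e₁⟩ := h₁.integral_Ioi_le hα
  obtain ⟨C₂, -, e₂⟩ := h₂.integral_Ioi_le hα
  refine ⟨C₁, C₂, ?_⟩
  filter_upwards [e₁, e₂, eventually_ge_atTop 0] with x ⟨i₁, b₁⟩ ⟨i₂, b₂⟩ hx
  set F : ℝ → ℝ := fun y => H₁ y * H₂ (x - y) with hF
  have hF0 : ∀ y, 0 ≤ F y := fun y => mul_nonneg (h₁.nonneg _) (h₂.nonneg _)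
  have hFm : Measurable F := by
    have := h₁.antitone.measurable
    have := h₂.antitone.measurable
    fun_prop
  have hFc : IntegrableOn F (Set.Ioc 0 x) := by
    refine Measure.integrableOn_of_bounded (M := 1) (by simp) hFm.aestronglyMeasurable
      (Eventually.of_forall fun y => ?_)
    rw [Real.norm_of_nonneg (hF0 y)]
    exact mul_le_one₀ (h₁.le_one _) (h₂.nonneg _) (h₂.le_one _)
  have iA : Integrable ((Set.Ioc 0 x).indicator F) := hFc.integrable_indicator measurableSet_Ioc
  have iB : Integrable ((Set.Ioi x).indicator H₁) := i₁.integrable_indicator measurableSet_Ioi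
  have iC' : Integrable ((Set.Ici x).indicator H₂) :=
    ((integrableOn_Ici_iff_integrableOn_Ioi).2 i₂).integrable_indicator measurableSet_Ici
  have iC : Integrable fun y => (Set.Ici x).indicator H₂ (x - y) := iC'.comp_sub_left x
  have iAB : Integrable fun y => (Set.Ioc 0 x).indicator F y + (Set.Ioi x).indicator H₁ y :=
    iA.add iB
  have hub : ∀ y, F y ≤ (Set.Ioc 0 x).indicator F y + (Set.Ioi x).indicator H₁ y
      + (Set.Ici x).indicator H₂ (x - y) := by
    intro y
    have n1 : 0 ≤ (Set.Ioc 0 x).indicator F y := Set.indicator_nonneg (fun y _ => hF0 y) y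
    have n2 : 0 ≤ (Set.Ioi x).indicator H₁ y := Set.indicator_nonneg (fun y _ => h₁.nonneg y) y
    have n3 : 0 ≤ (Set.Ici x).indicator H₂ (x - y) :=
      Set.indicator_nonneg (fun y _ => h₂.nonneg y) _
    rcases le_or_gt y 0 with hy | hy
    · rw [Set.indicator_of_mem (show x - y ∈ Set.Ici x by simpa using hy)] at n3 ⊢
      have : F y ≤ H₂ (x - y) := mul_le_of_le_one_left (h₂.nonneg _) (h₁.le_one _)
      linarith
    rcases le_or_gt y x with hyx | hyx
    · rw [Set.indicator_of_mem (show y ∈ Set.Ioc 0 x from ⟨hy, hyx⟩)]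
      linarith
    · rw [Set.indicator_of_mem (show y ∈ Set.Ioi x from hyx)] at n2 ⊢
      have : F y ≤ H₁ y := mul_le_of_le_one_right (h₁.nonneg _) (h₂.le_one _)
      linarith
  have iF : Integrable F := (iAB.add iC).mono' hFm.aestronglyMeasurable
    (Eventually.of_forall fun y => by
      rw [Real.norm_of_nonneg (hF0 y)]
      exact hub y)
  refine ⟨iF, ?_, ?_⟩
  · rw [intervalIntegral.integral_of_le hx]
    exact setIntegral_le_integral iF (Eventually.of_forall hF0)
  · have h3 := integral_mono iF (iAB.add iC) hub
    have h4 : ∫ y, ((Set.Ioc 0 x).indicator F y + (Set.Ioi x).indicator H₁ y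
        + (Set.Ici x).indicator H₂ (x - y)) = (∫ y in (0 : ℝ)..x, F y)
        + (∫ y in Set.Ioi x, H₁ y) + ∫ y in Set.Ioi x, H₂ y := by
      rw [integral_add iAB iC, integral_add iA iB,
        integral_sub_left_eq_self (fun y => (Set.Ici x).indicator H₂ y) volume x,
        integral_indicator measurableSet_Ioc, integral_indicator measurableSet_Ioi,
        integral_indicator measurableSet_Ici, integral_Ici_eq_integral_Ioi,
        intervalIntegral.integral_of_le hx]
    simp only [Pi.add_apply] at h3
    rw [h4] at h3
    linarith

theorem tendsto_convolution (h₁ : IsExpRegVarTail α γ₁ H₁) (h₂ : IsExpRegVarTail α γ₂ H₂)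
    (hα : 0 < α) (hγ₁ : -1 < γ₁) (hγ₂ : -1 < γ₂) :
    Tendsto (fun x => Real.exp (α * x) * (∫ y, H₁ y * H₂ (x - y)) /
      (x * (Real.exp (α * x) * H₁ x) * (Real.exp (α * x) * H₂ x))) atTop
      (nhds (Beta (γ₁ + 1) (γ₂ + 1))) := by
  obtain ⟨C₁, C₂, hC⟩ := h₁.convolution_bounds h₂ hα
  have hM := RegVar.tendsto_integral_mul hγ₁ hγ₂ h₁.measurable_exp_mul h₂.measurable_exp_mul
    (fun x => mul_nonneg (Real.exp_pos _).le (h₁.nonneg _))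
    (fun x => mul_nonneg (Real.exp_pos _).le (h₂.nonneg _))
    (h₁.exp_mul_bdd hα) (h₂.exp_mul_bdd hα) h₁.eventually_exp_mul_pos h₂.eventually_exp_mul_pos
    h₁.regVar h₂.regVar
  have hMeq : ∀ᶠ x in atTop, ∫ s in (0 : ℝ)..1,
      Real.exp (α * (x * s)) * H₁ (x * s) / (Real.exp (α * x) * H₁ x) *
        (Real.exp (α * (x * (1 - s))) * H₂ (x * (1 - s)) / (Real.exp (α * x) * H₂ x)) =
      Real.exp (α * x) * (∫ y in (0 : ℝ)..x, H₁ y * H₂ (x - y)) /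
        (x * (Real.exp (α * x) * H₁ x) * (Real.exp (α * x) * H₂ x)) := by
    filter_upwards [eventually_gt_atTop 0] with x hx
    have e1 := intervalIntegral.mul_integral_comp_mul_left (a := 0) (b := 1)
      (f := fun y => H₁ y * H₂ (x - y)) x
    rw [mul_zero, mul_one] at e1
    rw [← e1, ← intervalIntegral.integral_const_mul, ← intervalIntegral.integral_const_mul,
      ← intervalIntegral.integral_div]
    refine intervalIntegral.integral_congr fun s _ => ?_
    have e2 : Real.exp (α * x) = Real.exp (α * (x * s)) * Real.exp (α * (x * (1 - s))) := by
      rw [← Real.exp_add]; ring_nf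
    have e3 : x * (1 - s) = x - x * s := by ring
    rw [div_mul_div_comm, mul_assoc x, mul_left_comm (Real.exp (α * x)) x,
      mul_div_mul_left _ _ hx.ne']
    congr 1
    rw [e2, e3]; ring
  have hlow := hM.congr' hMeq
  have z₁ := (h₁.tendsto_self_mul_atTop hα hγ₁).inv_tendsto_atTop.const_mul C₂
  have z₂ := (h₂.tendsto_self_mul_atTop hα hγ₂).inv_tendsto_atTop.const_mul C₁
  have hup := (hlow.add z₂).add z₁
  rw [mul_zero, mul_zero, add_zero, add_zero] at hup
  refine tendsto_of_tendsto_of_tendsto_of_le_of_le' hlow hup ?_ ?_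
  · filter_upwards [hC, h₁.eventually_pos, h₂.eventually_pos, eventually_gt_atTop 0]
      with x hx p₁ p₂ hx0
    gcongr
    exact hx.2.1
  · filter_upwards [hC, h₁.eventually_pos, h₂.eventually_pos, eventually_gt_atTop 0]
      with x hx p₁ p₂ hx0
    have he := Real.exp_pos (α * x)
    calc _ ≤ Real.exp (α * x) *
          ((∫ y in (0 : ℝ)..x, H₁ y * H₂ (x - y)) + C₁ * H₁ x + C₂ * H₂ x) /
          (x * (Real.exp (α * x) * H₁ x) * (Real.exp (α * x) * H₂ x)) := by
          gcongr
          exact hx.2.2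
      _ = _ := by
        simp only [Pi.inv_apply]
        field_simp

end IsExpRegVarTail

/-- Differencing step: if `P` is the (approximate) negative derivative of `J` in the sense that
`h * P (x + h) ≤ J x - J (x + h) ≤ h * P x`, then exponential asymptotics pass from `J` to `P`. -/
theorem tendsto_of_difference_bounds {J P L : ℝ → ℝ} {α B : ℝ}
    (hL : ∀ᶠ x in atTop, 0 < L x)
    (hLs : ∀ h > 0, Tendsto (fun x => L (x + h) / L x) atTop (nhds 1))
    (hJ : Tendsto (fun x => Real.exp (α * x) * J x / L x) atTop (nhds B))
    (hlow : ∀ h > 0, ∀ᶠ x in atTop, J x ≤ J (x + h) + h * P x)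
    (hup : ∀ h > 0, ∀ᶠ x in atTop, J (x + h) + h * P (x + h) ≤ J x) :
    Tendsto (fun x => Real.exp (α * x) * P x / L x) atTop (nhds (α * B)) := by
  have hshift : ∀ h : ℝ, Tendsto (fun x : ℝ => x + h) atTop atTop := fun h =>
    tendsto_atTop_add_const_right atTop h tendsto_id
  have hder : ∀ c : ℝ, Tendsto (fun h => h⁻¹ * (B * (Real.exp (c * h) - 1)))
      (nhdsWithin 0 (Set.Ioi 0)) (nhds (c * B)) := by
    intro c
    have h1 : HasDerivAt (fun h => B * Real.exp (c * h)) (B * (Real.exp (c * 0) * (c * 1))) 0 :=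
      (((hasDerivAt_id (0 : ℝ)).const_mul c).exp).const_mul B
    have h2 := h1.tendsto_slope_zero_right
    simp only [mul_zero, Real.exp_zero, mul_one, one_mul, zero_add, smul_eq_mul] at h2
    rw [mul_comm c B]
    refine h2.congr fun h => ?_
    ring
  have hpos : ∀ᶠ h in nhdsWithin (0 : ℝ) (Set.Ioi 0), 0 < h := self_mem_nhdsWithin
  rw [tendsto_order]
  constructor
  · intro a ha
    obtain ⟨h, hh, h0⟩ := (((hder (-α)).neg.eventually (lt_mem_nhds
      (show a < -(-α * B) by linarith))).and hpos).exists
    have e1 : Tendsto (fun x => h⁻¹ * (Real.exp (α * x) * J x / L x - Real.exp (-α * h) *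
        (L (x + h) / L x) * (Real.exp (α * (x + h)) * J (x + h) / L (x + h)))) atTop
        (nhds (h⁻¹ * (B - Real.exp (-α * h) * 1 * B))) :=
      (hJ.sub (((hLs h h0).const_mul _).mul (hJ.comp (hshift h)))).const_mul _
    filter_upwards [e1.eventually (lt_mem_nhds (show a < h⁻¹ * (B - Real.exp (-α * h) * 1 * B) by
      linarith)),
      hlow h h0, hL, (hshift h).eventually hL] with x h1 h2 h3 h4
    refine h1.trans_le ?_
    have e2 : Real.exp (α * (x + h)) = Real.exp (α * x) * Real.exp (α * h) := by
      rw [← Real.exp_add]; ring_nf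
    rw [show -α * h = -(α * h) by ring, Real.exp_neg, e2]
    have e3 := Real.exp_pos (α * h)
    have e4 := Real.exp_pos (α * x)
    calc _ = Real.exp (α * x) * ((J x - J (x + h)) / h) / L x := by field_simp
      _ ≤ _ := by
        gcongr
        rw [div_le_iff₀ h0]; linarith
  · intro a ha
    obtain ⟨h, hh, h0⟩ := (((hder α).eventually (gt_mem_nhds ha)).and hpos).exists
    have e1 : Tendsto (fun x => h⁻¹ * (Real.exp (α * h) * (L (x + h) / L x)⁻¹ *
        (Real.exp (α * x) * J x / L x) - Real.exp (α * (x + h)) * J (x + h) / L (x + h))) atTop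
        (nhds (h⁻¹ * (Real.exp (α * h) * 1⁻¹ * B - B))) :=
      (((((hLs h h0).inv₀ one_ne_zero).const_mul _).mul hJ).sub
        (hJ.comp (hshift h))).const_mul _
    have e5 : ∀ᶠ x in atTop, Real.exp (α * (x + h)) * P (x + h) / L (x + h) < a := by
      filter_upwards [e1.eventually (gt_mem_nhds (show h⁻¹ * (Real.exp (α * h) * 1⁻¹ * B - B) < a by
        rw [inv_one]; linarith)),
        hup h h0, hL, (hshift h).eventually hL] with x h1 h2 h3 h4
      refine lt_of_le_of_lt ?_ h1
      have e2 : Real.exp (α * (x + h)) = Real.exp (α * x) * Real.exp (α * h) := by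
        rw [← Real.exp_add]; ring_nf
      have e3 := Real.exp_pos (α * h)
      have e4 := Real.exp_pos (α * x)
      rw [e2]
      calc _ ≤ Real.exp (α * x) * Real.exp (α * h) * ((J x - J (x + h)) / h) / L (x + h) := by
            gcongr
            rw [le_div_iff₀ h0]; linarith
        _ = _ := by field_simp
    filter_upwards [(hshift (-h)).eventually e5] with x hx
    simpa using hx

section Product

variable (μ₁ μ₂ : Measure ℝ) [IsProbabilityMeasure μ₁] [IsProbabilityMeasure μ₂]

/-- The length of `{y | exp y < p₁, exp (x - y) < p₂}` is `(log p₁ + log p₂ - x)⁺`. -/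
theorem volume_exp_lt_exp_sub_lt (x : ℝ) (p : ℝ × ℝ) :
    volume {y : ℝ | Real.exp y < p.1 ∧ Real.exp (x - y) < p.2} =
      if 0 < p.1 ∧ 0 < p.2 then ENNReal.ofReal (Real.log p.1 + Real.log p.2 - x) else 0 := by
  split_ifs with hp
  · have : {y : ℝ | Real.exp y < p.1 ∧ Real.exp (x - y) < p.2} =
        Set.Ioo (x - Real.log p.2) (Real.log p.1) := by
      ext y
      simp only [Set.mem_ofPred_eq, Set.mem_Ioo]
      rw [← Real.lt_log_iff_exp_lt hp.1, ← Real.lt_log_iff_exp_lt hp.2]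
      constructor <;> rintro ⟨h1, h2⟩ <;> constructor <;> linarith
    rw [this, Real.volume_Ioo]
    congr 1; ring
  · convert measure_empty (μ := (volume : Measure ℝ))
    refine Set.eq_empty_of_forall_notMem fun y hy => hp ?_
    exact ⟨(Real.exp_pos _).trans hy.1, (Real.exp_pos _).trans hy.2⟩

theorem exp_lt_max_mul_max_iff (x : ℝ) (p : ℝ × ℝ) :
    Real.exp x < max p.1 0 * max p.2 0 ↔
      (0 < p.1 ∧ 0 < p.2) ∧ x < Real.log p.1 + Real.log p.2 := by
  by_cases hp : 0 < p.1 ∧ 0 < p.2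
  · rw [max_eq_left hp.1.le, max_eq_left hp.2.le, ← Real.log_mul hp.1.ne' hp.2.ne',
      Real.lt_log_iff_exp_lt (mul_pos hp.1 hp.2)]
    simp [hp]
  · have : max p.1 0 * max p.2 0 = 0 := by
      rcases not_and_or.1 hp with h | h
      · rw [max_eq_right (not_lt.1 h), zero_mul]
      · rw [max_eq_right (not_lt.1 h), mul_zero]
    simp [hp, this, (Real.exp_pos x).le]

theorem lintegral_tail_mul_tail (x : ℝ) :
    ∫⁻ y, μ₁ (Set.Ioi (Real.exp y)) * μ₂ (Set.Ioi (Real.exp (x - y))) =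
      ∫⁻ p, volume {y : ℝ | Real.exp y < p.1 ∧ Real.exp (x - y) < p.2} ∂(μ₁.prod μ₂) := by
  set S : Set (ℝ × (ℝ × ℝ)) := {q | Real.exp q.1 < q.2.1 ∧ Real.exp (x - q.1) < q.2.2} with hS
  have hSm : MeasurableSet S :=
    (measurableSet_lt (f := fun q : ℝ × (ℝ × ℝ) => Real.exp q.1) (g := fun q => q.2.1)
      (by fun_prop) (by fun_prop)).inter
      (measurableSet_lt (f := fun q : ℝ × (ℝ × ℝ) => Real.exp (x - q.1)) (g := fun q => q.2.2)
        (by fun_prop) (by fun_prop))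
  have h1 := Measure.prod_apply (μ := (volume : Measure ℝ)) (ν := μ₁.prod μ₂) hSm
  have h2 := Measure.prod_apply_symm (μ := (volume : Measure ℝ)) (ν := μ₁.prod μ₂) hSm
  rw [h1] at h2
  refine Eq.trans ?_ h2
  refine lintegral_congr fun y => ?_
  rw [← Measure.prod_prod]
  rfl

theorem measurableSet_lt_max_mul_max (c : ℝ) :
    MeasurableSet {p : ℝ × ℝ | c < max p.1 0 * max p.2 0} :=
  measurableSet_lt (by fun_prop) (by fun_prop)

theorem lintegral_tail_le_add (x h : ℝ) :
    ∫⁻ y, μ₁ (Set.Ioi (Real.exp y)) * μ₂ (Set.Ioi (Real.exp (x - y))) ≤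
      (∫⁻ y, μ₁ (Set.Ioi (Real.exp y)) * μ₂ (Set.Ioi (Real.exp (x + h - y)))) +
        ENNReal.ofReal h *
          (μ₁.prod μ₂) {p : ℝ × ℝ | Real.exp x < max p.1 0 * max p.2 0} := by
  rw [lintegral_tail_mul_tail, lintegral_tail_mul_tail,
    ← lintegral_indicator_const (measurableSet_lt_max_mul_max _), ← lintegral_add_right _
      (measurable_const.indicator (measurableSet_lt_max_mul_max _))]
  refine lintegral_mono fun p => ?_
  simp only [volume_exp_lt_exp_sub_lt, Set.indicator, Set.mem_ofPred_eq, exp_lt_max_mul_max_iff]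
  split_ifs with h1 h2 h2
  · refine le_trans (ENNReal.ofReal_le_ofReal (le_of_eq ?_)) ENNReal.ofReal_add_le
    ring
  · rw [ENNReal.ofReal_of_nonpos]
    · exact zero_le
    · have := not_and.1 h2 h1
      linarith
  all_goals exact zero_le

theorem add_le_lintegral_tail {x h : ℝ} (hh : 0 < h) :
    (∫⁻ y, μ₁ (Set.Ioi (Real.exp y)) * μ₂ (Set.Ioi (Real.exp (x + h - y)))) +
        ENNReal.ofReal h *
          (μ₁.prod μ₂) {p : ℝ × ℝ | Real.exp (x + h) < max p.1 0 * max p.2 0} ≤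
      ∫⁻ y, μ₁ (Set.Ioi (Real.exp y)) * μ₂ (Set.Ioi (Real.exp (x - y))) := by
  rw [lintegral_tail_mul_tail, lintegral_tail_mul_tail,
    ← lintegral_indicator_const (measurableSet_lt_max_mul_max _), ← lintegral_add_right _
      (measurable_const.indicator (measurableSet_lt_max_mul_max _))]
  refine lintegral_mono fun p => ?_
  simp only [volume_exp_lt_exp_sub_lt, Set.indicator, Set.mem_ofPred_eq, exp_lt_max_mul_max_iff]
  split_ifs with h1 h2 h2
  · rw [← ENNReal.ofReal_add (by linarith [h2.2]) hh.le]
    exact ENNReal.ofReal_le_ofReal (by linarith)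
  · rw [add_zero]
    exact ENNReal.ofReal_le_ofReal (by linarith)
  · exact absurd h2.1 h1
  · simp

theorem ofReal_integral_tail {x : ℝ}
    (hi : Integrable fun y => (μ₁ (Set.Ioi (Real.exp y))).toReal *
      (μ₂ (Set.Ioi (Real.exp (x - y)))).toReal) :
    ∫⁻ y, μ₁ (Set.Ioi (Real.exp y)) * μ₂ (Set.Ioi (Real.exp (x - y))) =
      ENNReal.ofReal (∫ y, (μ₁ (Set.Ioi (Real.exp y))).toReal *
        (μ₂ (Set.Ioi (Real.exp (x - y)))).toReal) := by
  rw [ofReal_integral_eq_lintegral_ofReal hi (Eventually.of_forall fun y => by positivity)]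
  refine lintegral_congr fun y => ?_
  rw [ENNReal.ofReal_mul ENNReal.toReal_nonneg, ENNReal.ofReal_toReal (measure_ne_top _ _),
    ENNReal.ofReal_toReal (measure_ne_top _ _)]

end Product

theorem isExpRegVarTail_of_isEquivalent (μ : Measure ℝ) [IsProbabilityMeasure μ] {α γ : ℝ}
    {f : ℝ → ℝ} (hev : ∀ᶠ x in atTop, 0 < f x)
    (hrv : ∀ t : ℝ, 0 < t → Tendsto (fun x => f (x * t) / f x) atTop (nhds (t ^ γ)))
    (htail : (fun x => (μ (Set.Ioi x)).toReal) ~[atTop] (fun x => x ^ (-α) * f (Real.log x))) :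
    IsExpRegVarTail α γ (fun u => (μ (Set.Ioi (Real.exp u))).toReal) ∧
      (fun u => Real.exp (α * u) * (μ (Set.Ioi (Real.exp u))).toReal) ~[atTop] f := by
  set g : ℝ → ℝ := fun u => Real.exp (α * u) * (μ (Set.Ioi (Real.exp u))).toReal with hg
  have hgf : g ~[atTop] f := by
    have h1 := (IsEquivalent.refl (u := fun u => Real.exp (α * u)) (l := atTop)).mul
      (htail.comp_tendsto Real.tendsto_exp_atTop)
    refine h1.congr_right (Eventually.of_forall fun u => ?_)
    simp only [Pi.mul_apply, Function.comp_apply, Real.log_exp]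
    rw [← Real.exp_mul, ← mul_assoc, ← Real.exp_add,
      show α * u + u * -α = 0 by ring, Real.exp_zero, one_mul]
  have hratio : Tendsto (fun u => g u / f u) atTop (nhds 1) :=
    (isEquivalent_iff_tendsto_one (hev.mono fun _ h => h.ne')).1 hgf
  have hgpos : ∀ᶠ u in atTop, 0 < g u := by
    filter_upwards [hratio.eventually (lt_mem_nhds one_pos), hev] with u h1 h2
    exact (div_pos_iff_of_pos_right h2).1 h1
  refine ⟨⟨?_, fun u => ENNReal.toReal_nonneg, fun u => ?_, ?_, fun t ht => ?_⟩, hgf⟩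
  · intro u v huv
    exact ENNReal.toReal_mono (measure_ne_top _ _)
      (measure_mono (Set.Ioi_subset_Ioi (Real.exp_le_exp.2 huv)))
  · exact ENNReal.toReal_le_of_le_ofReal zero_le_one (by simpa using prob_le_one)
  · exact hgpos.mono fun u hu => pos_of_mul_pos_right hu (Real.exp_pos _).le
  · have hmul : Tendsto (fun u : ℝ => u * t) atTop atTop := tendsto_id.atTop_mul_const ht
    have h1 := ((hratio.comp hmul).mul (hrv t ht)).mul (hratio.inv₀ one_ne_zero)
    rw [one_mul, inv_one, mul_one] at h1
    refine h1.congr' ?_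
    filter_upwards [hev, hgpos, hmul.eventually hev] with u h2 h3 h4
    simp only [Function.comp_apply]
    change _ = g (u * t) / g u
    field_simp

/-- For independent `X₁, X₂` with `F̄ᵢ(x) ∼ x^{-α} fᵢ(ln x)`, `fᵢ` regularly varying of
index `γᵢ > -1` (so `Fᵢ ∈ 𝓡₁₁(α)`), non-lattice in the sense of `ln Xᵢ⁺`:
`P(X₁⁺ X₂⁺ > x) ∼ α B(γ₁+1, γ₂+1) x^{-α} (ln x) f₁(ln x) f₂(ln x)`. -/
theorem product_tail_semiRegVar (μ₁ μ₂ : Measure ℝ)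
    [IsProbabilityMeasure μ₁] [IsProbabilityMeasure μ₂]
    (α γ₁ γ₂ : ℝ) (hα : 0 < α) (hγ₁ : -1 < γ₁) (hγ₂ : -1 < γ₂) (f₁ f₂ : ℝ → ℝ)
    (hnl1 : ¬ IsLatticeMeasure (μ₁.map (fun x => Real.log (max x 0))))
    (hnl2 : ¬ IsLatticeMeasure (μ₂.map (fun x => Real.log (max x 0))))
    (hfnn₁ : ∀ x, 0 ≤ f₁ x) (hfnn₂ : ∀ x, 0 ≤ f₂ x)
    (hlb₁ : ∀ r : ℝ, ∃ C : ℝ, ∀ x ∈ Set.Icc (0:ℝ) r, f₁ x ≤ C)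
    (hlb₂ : ∀ r : ℝ, ∃ C : ℝ, ∀ x ∈ Set.Icc (0:ℝ) r, f₂ x ≤ C)
    (hev₁ : ∀ᶠ x in atTop, 0 < f₁ x) (hev₂ : ∀ᶠ x in atTop, 0 < f₂ x)
    (hrv₁ : ∀ t : ℝ, 0 < t → Tendsto (fun x => f₁ (x * t) / f₁ x) atTop (nhds (t ^ γ₁)))
    (hrv₂ : ∀ t : ℝ, 0 < t → Tendsto (fun x => f₂ (x * t) / f₂ x) atTop (nhds (t ^ γ₂)))
    (htail₁ : (fun x => (μ₁ (Set.Ioi x)).toReal) ~[atTop]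
      (fun x => x ^ (-α) * f₁ (Real.log x)))
    (htail₂ : (fun x => (μ₂ (Set.Ioi x)).toReal) ~[atTop]
      (fun x => x ^ (-α) * f₂ (Real.log x))) :
    (fun x => ((μ₁.prod μ₂) {p : ℝ × ℝ | x < max p.1 0 * max p.2 0}).toReal) ~[atTop]
      (fun x => α * Beta (γ₁ + 1) (γ₂ + 1) * x ^ (-α) * Real.log x *
        f₁ (Real.log x) * f₂ (Real.log x)) := by
  obtain ⟨h₁, e₁⟩ := isExpRegVarTail_of_isEquivalent μ₁ hev₁ hrv₁ htail₁
  obtain ⟨h₂, e₂⟩ := isExpRegVarTail_of_isEquivalent μ₂ hev₂ hrv₂ htail₂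
  set H₁ : ℝ → ℝ := fun u => (μ₁ (Set.Ioi (Real.exp u))).toReal with hH₁
  set H₂ : ℝ → ℝ := fun u => (μ₂ (Set.Ioi (Real.exp u))).toReal with hH₂
  set L : ℝ → ℝ := fun x => x * (Real.exp (α * x) * H₁ x) * (Real.exp (α * x) * H₂ x) with hL
  set P : ℝ → ℝ := fun x =>
    ((μ₁.prod μ₂) {p : ℝ × ℝ | Real.exp x < max p.1 0 * max p.2 0}).toReal with hP
  set J : ℝ → ℝ := fun x => ∫ y, H₁ y * H₂ (x - y) with hJ
  have hJ0 : ∀ x, 0 ≤ J x := fun x =>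
    integral_nonneg fun y => mul_nonneg (h₁.nonneg _) (h₂.nonneg _)
  have hshift : ∀ h : ℝ, Tendsto (fun x : ℝ => x + h) atTop atTop := fun h =>
    tendsto_atTop_add_const_right atTop h tendsto_id
  have hLpos : ∀ᶠ x in atTop, 0 < L x := by
    filter_upwards [eventually_gt_atTop 0, h₁.eventually_exp_mul_pos, h₂.eventually_exp_mul_pos]
      with x p₀ p₁ p₂
    positivity
  obtain ⟨C₁, C₂, hC⟩ := h₁.convolution_bounds h₂ hα
  have hJint : ∀ᶠ x in atTop,
      ∫⁻ y, μ₁ (Set.Ioi (Real.exp y)) * μ₂ (Set.Ioi (Real.exp (x - y))) = ENNReal.ofReal (J x) :=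
    hC.mono fun x hx => ofReal_integral_tail μ₁ μ₂ hx.1
  have hPeq : ∀ x, (μ₁.prod μ₂) {p : ℝ × ℝ | Real.exp x < max p.1 0 * max p.2 0} =
      ENNReal.ofReal (P x) := fun x => (ENNReal.ofReal_toReal (measure_ne_top _ _)).symm
  have hP0 : ∀ x, 0 ≤ P x := fun x => ENNReal.toReal_nonneg
  have hB := Beta_pos (a := γ₁ + 1) (b := γ₂ + 1) (by linarith) (by linarith)
  have hlim : Tendsto (fun x => Real.exp (α * x) * P x / L x) atTop
      (nhds (α * Beta (γ₁ + 1) (γ₂ + 1))) := by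
    refine tendsto_of_difference_bounds hLpos (fun h hh => ?_)
      (h₁.tendsto_convolution h₂ hα hγ₁ hγ₂) (fun h hh => ?_) (fun h hh => ?_)
    · have hx : Tendsto (fun x : ℝ => (x + h) / x) atTop (nhds 1) := by
        have := (tendsto_const_nhds (x := h)).div_atTop (tendsto_id (α := ℝ)) |>.const_add 1
        rw [add_zero] at this
        refine this.congr' ?_
        filter_upwards [eventually_ne_atTop 0] with x hx
        simp only [id]
        field_simp
      have h3 := (hx.mul (h₁.tendsto_shift_div hh.le)).mul (h₂.tendsto_shift_div hh.le)
      rw [one_mul, one_mul] at h3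
      refine h3.congr fun x => ?_
      rw [div_mul_div_comm, div_mul_div_comm]
    · filter_upwards [hJint, (hshift h).eventually hJint] with x i₁ i₂
      have h3 := lintegral_tail_le_add μ₁ μ₂ x h
      rw [i₁, i₂, hPeq, ← ENNReal.ofReal_mul hh.le,
        ← ENNReal.ofReal_add (hJ0 _) (mul_nonneg hh.le (hP0 _))] at h3
      exact (ENNReal.ofReal_le_ofReal_iff
        (add_nonneg (hJ0 _) (mul_nonneg hh.le (hP0 _)))).1 h3
    · filter_upwards [hJint, (hshift h).eventually hJint] with x i₁ i₂
      have h3 := add_le_lintegral_tail μ₁ μ₂ (x := x) hh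
      rw [i₁, i₂, hPeq, ← ENNReal.ofReal_mul hh.le,
        ← ENNReal.ofReal_add (hJ0 _) (mul_nonneg hh.le (hP0 _))] at h3
      exact (ENNReal.ofReal_le_ofReal_iff (hJ0 _)).1 h3
  have hequiv : P ~[atTop] fun u =>
      α * Beta (γ₁ + 1) (γ₂ + 1) * (Real.exp (-(α * u)) * u * f₁ u * f₂ u) := by
    have h3 := ((isEquivalent_const_iff_tendsto (mul_pos hα hB).ne').2 hlim).mul
      (((IsEquivalent.refl (u := fun u => Real.exp (-(α * u)) * u) (l := atTop)).mul e₁).mul e₂)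
    refine h3.congr_left ?_
    filter_upwards [hLpos, eventually_gt_atTop 0, h₁.eventually_pos, h₂.eventually_pos]
      with u hu u0 p₁ p₂
    simp only [Pi.mul_apply, hL, hH₁, hH₂] at p₁ p₂ ⊢
    rw [Real.exp_neg]
    field_simp
  have hfin := hequiv.comp_tendsto Real.tendsto_log_atTop
  refine (hfin.congr_left ?_).congr_right ?_
  · filter_upwards [eventually_gt_atTop 0] with x hx
    simp only [Function.comp_apply, hP, Real.exp_log hx]
  · filter_upwards [eventually_gt_atTop 0] with x hx
    simp only [Function.comp_apply]
    rw [Real.rpow_def_of_pos hx, show Real.log x * -α = -(α * Real.log x) by ring]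
    ring
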